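/- arXiv:2308.10432 — 8 statements merged into one kernel-verified Lean document; each statement's English description precedes it below -/
import Mathlib

section
/- Let H be a real number. A pair (a,b) of real numbers satisfies the two equations H/2 − 2a² − 2b = 0 and −2a² − 2ab + b + 1/2 = 0 if and only if either (a,b) = (1/2, (H−1)/4), or H ≥ −3 and (a,b) = ((1+√(H+3))/2, (−2−√(H+3))/2) or (a,b) = ((1−√(H+3))/2, (−2+√(H+3))/2). -/
/-- Integrability condition for SqK-spinors of type `(a,b)` on a three-dimensional
Riemannian Sasakian space-form with φ-sectional curvature `H`. -/
theorem stmt0 (H a b : ℝ) :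
    (H / 2 - 2 * a ^ 2 - 2 * b = 0 ∧ -2 * a ^ 2 - 2 * a * b + b + 1 / 2 = 0) ↔
      ((a, b) = (1 / 2, (H - 1) / 4) ∨
        (-3 ≤ H ∧
          ((a, b) = ((1 + Real.sqrt (H + 3)) / 2, (-2 - Real.sqrt (H + 3)) / 2) ∨
            (a, b) = ((1 - Real.sqrt (H + 3)) / 2, (-2 + Real.sqrt (H + 3)) / 2)))) := by
  simp only [Prod.mk.injEq]
  constructor
  · rintro ⟨h1, h2⟩
    have hf : (1 - 2 * a) * ((1 + 2 * a) / 2 + b) = 0 := by linarith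
    rcases mul_eq_zero.mp hf with h | h
    · left
      have ha : a = 1 / 2 := by linarith
      subst ha
      exact ⟨rfl, by linarith⟩
    · right
      have hb : b = -(1 + 2 * a) / 2 := by linarith
      subst hb
      have hH : H + 3 = (2 * a - 1) ^ 2 := by linarith
      refine ⟨by nlinarith [sq_nonneg (2 * a - 1)], ?_⟩
      rw [hH, Real.sqrt_sq_eq_abs]
      rcases abs_choice (2 * a - 1) with h' | h' <;> rw [h']
      · left; constructor <;> ring
      · right; constructor <;> ring
  · rintro (⟨rfl, rfl⟩ | ⟨hH, ⟨rfl, rfl⟩ | ⟨rfl, rfl⟩⟩)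
    · constructor <;> ring
    all_goals
      have hs := Real.sq_sqrt (show 0 ≤ H + 3 by linarith)
      constructor <;> linarith
end

section
/- Let a, b be real numbers with b ≠ 0 and let J = (J₁, J₂, J₃) ∈ ℝ³. Define, for i, j ∈ {1,2,3}, K_{ji} = Σ_{k=1}^{3} (2a ε_{jik} + 2b δ_{j1} ε_{1ik}) J_k, where ε is the Levi-Civita symbol on {1,2,3} (totally antisymmetric with ε₁₂₃ = 1) and δ is the Kronecker delta. Then K_{ji} + K_{ij} = 0 for all i, j ∈ {1,2,3} if and only if J₂ = J₃ = 0. -/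
/-- The Levi-Civita symbol on three indices (here `0,1,2` standing for `1,2,3`),
totally antisymmetric with `eps 0 1 2 = 1`. -/
noncomputable def eps (i j k : Fin 3) : ℝ :=
  ((j : ℝ) - (i : ℝ)) * ((k : ℝ) - (j : ℝ)) * ((k : ℝ) - (i : ℝ)) / 2

/-- The components `K_{ji} = Σ_k (2a ε_{jik} + 2b δ_{j1} ε_{1ik}) J_k` of the covariant
derivative of the Dirac current of an SqK-spinor of type `(a,b)` (index `0` stands for `1`). -/
noncomputable def Kc (a b : ℝ) (J : Fin 3 → ℝ) (j i : Fin 3) : ℝ :=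
  ∑ k : Fin 3, (2 * a * eps j i k + 2 * b * (if j = 0 then 1 else 0) * eps 0 i k) * J k

/-- For `b ≠ 0`, the symmetric part of `K` vanishes (i.e. the Dirac current is a Killing
vector field) if and only if `J₂ = J₃ = 0`. -/
theorem stmt3 (a b : ℝ) (hb : b ≠ 0) (J : Fin 3 → ℝ) :
    (∀ i j : Fin 3, Kc a b J j i + Kc a b J i j = 0) ↔ (J 1 = 0 ∧ J 2 = 0) := by
  constructor
  · intro h
    have h1 := h 0 1
    have h2 := h 0 2
    simp [Kc, eps, Fin.sum_univ_three] at h1 h2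
    ring_nf at h1 h2
    constructor
    · apply mul_left_cancel₀ hb
      linarith
    · apply mul_left_cancel₀ hb
      linarith
  · rintro ⟨h1, h2⟩ i j
    fin_cases i <;> fin_cases j <;> simp [Kc, eps, Fin.sum_univ_three, h1, h2] <;> ring
end

section
/- Define δ((a₁,b₁),(a₂,b₂)) = 3(a₂ − a₁) + (b₂ − b₁). (1) For H > −3 with s = √(H+3) and the pairs P₀ = (1/2, (H−1)/4), P₊ = ((1+s)/2, (−2−s)/2), P₋ = ((1−s)/2, (−2+s)/2): δ(P,P) = 0 for P ∈ {P₀,P₊,P₋}; δ(P₀,P₊) = 0 if and only if H = 13; δ(P₀,P₋) ≠ 0; and δ(P₊,P₋) ≠ 0. (2) For H < 3 with s' = √(3−H) and the pairs Q₀ = (−1/2, (H+1)/4), Q₊ = ((−1+s')/2, (2−s')/2), Q₋ = ((−1−s')/2, (2+s')/2): δ(Q,Q) = 0 for Q ∈ {Q₀,Q₊,Q₋}; δ(Q₀,Q₋) = 0 if and only if H = −13; δ(Q₀,Q₊) ≠ 0; and δ(Q₊,Q₋) ≠ 0. -/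
/-- `δ((a₁,b₁),(a₂,b₂)) = 3(a₂−a₁) + (b₂−b₁)`, whose vanishing is the closedness
condition for the two-form `F_{ψ₁,ψ₂}` built from SqK-spinors of these types. -/
def deltaF (p q : ℝ × ℝ) : ℝ := 3 * (q.1 - p.1) + (q.2 - p.2)

/-- Closedness of `F_{ψ₁,ψ₂}` for the various pairs of SqK types. -/
theorem stmt5 :
    (∀ H : ℝ, -3 < H →
      (∀ P ∈ ({(1 / 2, (H - 1) / 4),
               ((1 + Real.sqrt (H + 3)) / 2, (-2 - Real.sqrt (H + 3)) / 2),
               ((1 - Real.sqrt (H + 3)) / 2, (-2 + Real.sqrt (H + 3)) / 2)} : Set (ℝ × ℝ)),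
        deltaF P P = 0) ∧
      (deltaF (1 / 2, (H - 1) / 4)
          ((1 + Real.sqrt (H + 3)) / 2, (-2 - Real.sqrt (H + 3)) / 2) = 0 ↔ H = 13) ∧
      deltaF (1 / 2, (H - 1) / 4)
          ((1 - Real.sqrt (H + 3)) / 2, (-2 + Real.sqrt (H + 3)) / 2) ≠ 0 ∧
      deltaF ((1 + Real.sqrt (H + 3)) / 2, (-2 - Real.sqrt (H + 3)) / 2)
          ((1 - Real.sqrt (H + 3)) / 2, (-2 + Real.sqrt (H + 3)) / 2) ≠ 0) ∧
    (∀ H : ℝ, H < 3 →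
      (∀ Q ∈ ({(-1 / 2, (H + 1) / 4),
               ((-1 + Real.sqrt (3 - H)) / 2, (2 - Real.sqrt (3 - H)) / 2),
               ((-1 - Real.sqrt (3 - H)) / 2, (2 + Real.sqrt (3 - H)) / 2)} : Set (ℝ × ℝ)),
        deltaF Q Q = 0) ∧
      (deltaF (-1 / 2, (H + 1) / 4)
          ((-1 - Real.sqrt (3 - H)) / 2, (2 + Real.sqrt (3 - H)) / 2) = 0 ↔ H = -13) ∧
      deltaF (-1 / 2, (H + 1) / 4)
          ((-1 + Real.sqrt (3 - H)) / 2, (2 - Real.sqrt (3 - H)) / 2) ≠ 0 ∧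
      deltaF ((-1 + Real.sqrt (3 - H)) / 2, (2 - Real.sqrt (3 - H)) / 2)
          ((-1 - Real.sqrt (3 - H)) / 2, (2 + Real.sqrt (3 - H)) / 2) ≠ 0) := by
  constructor
  · intro H hH
    have hp : 0 < Real.sqrt (H + 3) := Real.sqrt_pos.mpr (by linarith)
    have hs : Real.sqrt (H + 3) * Real.sqrt (H + 3) = H + 3 :=
      Real.mul_self_sqrt (by linarith)
    generalize Real.sqrt (H + 3) = s at hp hs ⊢
    refine ⟨fun P _ => by simp [deltaF], ⟨fun h => ?_, fun h => ?_⟩, fun h => ?_, fun h => ?_⟩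
    · simp only [deltaF] at h
      have h4 : s * (s - 4) = 0 := by linarith
      rcases mul_eq_zero.mp h4 with h5 | h5
      · linarith
      · have h6 : s = 4 := by linarith
        subst h6
        linarith
    · subst h
      have h4 : (s - 4) * (s + 4) = 0 := by linarith
      rcases mul_eq_zero.mp h4 with h5 | h5
      · have h6 : s = 4 := by linarith
        subst h6
        norm_num [deltaF]
      · linarith
    · simp only [deltaF] at h
      nlinarith
    · simp only [deltaF] at h
      linarith
  · intro H hH
    have hp : 0 < Real.sqrt (3 - H) := Real.sqrt_pos.mpr (by linarith)
    have hs : Real.sqrt (3 - H) * Real.sqrt (3 - H) = 3 - H :=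
      Real.mul_self_sqrt (by linarith)
    generalize Real.sqrt (3 - H) = s at hp hs ⊢
    refine ⟨fun P _ => by simp [deltaF], ⟨fun h => ?_, fun h => ?_⟩, fun h => ?_, fun h => ?_⟩
    · simp only [deltaF] at h
      have h4 : s * (s - 4) = 0 := by linarith
      rcases mul_eq_zero.mp h4 with h5 | h5
      · linarith
      · have h6 : s = 4 := by linarith
        subst h6
        linarith
    · subst h
      have h4 : (s - 4) * (s + 4) = 0 := by linarith
      rcases mul_eq_zero.mp h4 with h5 | h5
      · have h6 : s = 4 := by linarith
        subst h6
        norm_num [deltaF]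
      · linarith
    · simp only [deltaF] at h
      nlinarith
    · simp only [deltaF] at h
      linarith
end

section
/- Let H be a real number and set Λ = 1. Then: (WEC) [for all real t,x,y with x²+y² < t², (H−1)t² + 2(x²+y²) ≥ 0] if and only if 1 ≤ H; (DEC) [for all real t,x,y with 0 < t and x²+y² ≤ t², one has 0 < (H−1)t and (H−1)²t² ≥ 4(x²+y²)] if and only if 3 ≤ H; (SEC) [for all real t,x,y with x²+y² < t², 4t² + (H−3)(x²+y²) ≥ 0] if and only if −1 ≤ H. -/
/-- Weak, dominant and strong energy conditions for the Einstein–Dirac solution of SqK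
type (i) (`Λ = 1`) on a three-dimensional Lorentzian Sasakian space-form. -/
theorem stmt11 (H : ℝ) :
    ((∀ t x y : ℝ, x ^ 2 + y ^ 2 < t ^ 2 →
        (H - 1) * t ^ 2 + 2 * (x ^ 2 + y ^ 2) ≥ 0) ↔ 1 ≤ H) ∧
    ((∀ t x y : ℝ, 0 < t → x ^ 2 + y ^ 2 ≤ t ^ 2 →
        0 < (H - 1) * t ∧ (H - 1) ^ 2 * t ^ 2 ≥ 4 * (x ^ 2 + y ^ 2)) ↔ 3 ≤ H) ∧
    ((∀ t x y : ℝ, x ^ 2 + y ^ 2 < t ^ 2 →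
        4 * t ^ 2 + (H - 3) * (x ^ 2 + y ^ 2) ≥ 0) ↔ -1 ≤ H) := by
  refine ⟨⟨fun h => ?_, fun h t x y hx => ?_⟩, ⟨fun h => ?_, fun h t x y ht hx => ⟨?_, ?_⟩⟩,
    ⟨fun h => ?_, fun h t x y hx => ?_⟩⟩
  · have := h 1 0 0 (by norm_num)
    linarith
  · have h1 : 0 ≤ (H - 1) * t ^ 2 := mul_nonneg (by linarith) (sq_nonneg t)
    nlinarith [sq_nonneg x, sq_nonneg y]
  · obtain ⟨h1, h2⟩ := h 1 1 0 (by norm_num) (by norm_num)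
    nlinarith
  · exact mul_pos (by linarith) ht
  · have h1 : 4 ≤ (H - 1) ^ 2 := by nlinarith
    have h2 := mul_le_mul_of_nonneg_right h1 (sq_nonneg t)
    linarith
  · by_contra hH
    have hH' : H < -1 := not_le.mp hH
    have h1 := h (3 - H) ((7 - H) / 2) 0 (by nlinarith)
    have h2 : 0 < (3 - H) * (-1 - H) ^ 2 :=
      mul_pos (by linarith) (pow_pos (by linarith) 2)
    nlinarith
  · have h1 : 0 ≤ (H + 1) * (x ^ 2 + y ^ 2) := mul_nonneg (by linarith) (by positivity)
    nlinarith
end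

section
/- Let H be a real number with H < 3, set s = √(3−H) and Λ = H − 2 − s. Then: (WEC) [for all real t,x,y with x²+y² < t², (H−Λ)t² + (1+Λ)(x²+y²) ≥ 0] if and only if −1 ≤ H; (DEC) [for all real t,x,y with 0 < t and x²+y² ≤ t², one has 0 < (H−Λ)t and (H−Λ)²t² ≥ (1+Λ)²(x²+y²)] if and only if −1 ≤ H; (SEC) [for all real t,x,y with x²+y² < t², 2(1+Λ)t² + (H−1−2Λ)(x²+y²) ≥ 0] if and only if 2 ≤ H. -/
/-- Weak, dominant and strong energy conditions for the Einstein–Dirac solution of SqK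
type (ii) (`Λ = H − 2 − √(3−H)`) on a three-dimensional Lorentzian Sasakian space-form. -/
theorem stmt12 (H : ℝ) (hH : H < 3) (s lambda : ℝ)
    (hs : s = Real.sqrt (3 - H)) (hlambda : lambda = H - 2 - s) :
    ((∀ t x y : ℝ, x ^ 2 + y ^ 2 < t ^ 2 →
        (H - lambda) * t ^ 2 + (1 + lambda) * (x ^ 2 + y ^ 2) ≥ 0) ↔ -1 ≤ H) ∧
    ((∀ t x y : ℝ, 0 < t → x ^ 2 + y ^ 2 ≤ t ^ 2 →
        0 < (H - lambda) * t ∧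
          (H - lambda) ^ 2 * t ^ 2 ≥ (1 + lambda) ^ 2 * (x ^ 2 + y ^ 2)) ↔ -1 ≤ H) ∧
    ((∀ t x y : ℝ, x ^ 2 + y ^ 2 < t ^ 2 →
        2 * (1 + lambda) * t ^ 2 + (H - 1 - 2 * lambda) * (x ^ 2 + y ^ 2) ≥ 0) ↔ 2 ≤ H) := by
  have h0 : 0 < s := by rw [hs]; exact Real.sqrt_pos.mpr (by linarith)
  have hsq : s ^ 2 = 3 - H := by rw [hs]; exact Real.sq_sqrt (by linarith)
  clear hs
  obtain rfl : H = 3 - s ^ 2 := by linarith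
  have e1 : 3 - s ^ 2 - lambda = 2 + s := by rw [hlambda]; ring
  have e2 : 1 + lambda = (2 + s) * (1 - s) := by rw [hlambda]; ring
  have e3 : 3 - s ^ 2 - 1 - 2 * lambda = (2 + s) * s := by rw [hlambda]; ring
  have h1 : -1 ≤ 3 - s ^ 2 ↔ s ≤ 2 := by
    constructor <;> intro h <;> nlinarith
  have h2 : 2 ≤ 3 - s ^ 2 ↔ s ≤ 1 := by
    constructor <;> intro h <;> nlinarith
  rw [e1, e2, e3, h1, h2]
  have hp : 0 < 2 + s := by linarith
  refine ⟨⟨fun h => ?_, fun h t x y hr => ?_⟩, ⟨fun h => ?_, fun h t x y ht hr => ?_⟩,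
    ⟨fun h => ?_, fun h t x y hr => ?_⟩⟩
  · by_contra! hc
    have q1 := Real.sq_sqrt h0.le
    have q2 := Real.sq_sqrt (show (0 : ℝ) ≤ 2 by norm_num)
    have := h (Real.sqrt s) (Real.sqrt 2) 0 (by rw [q1, q2]; linarith)
    rw [q1, q2] at this
    nlinarith
  · have hr0 : 0 ≤ x ^ 2 + y ^ 2 := by positivity
    generalize x ^ 2 + y ^ 2 = r at *
    have : 0 ≤ t ^ 2 + (1 - s) * r := by nlinarith
    have := mul_nonneg hp.le this
    linarith
  · have := (h 1 1 0 one_pos (by norm_num)).2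
    by_contra! hc
    have h3 : 0 < (2 + s) ^ 2 * (s * (s - 2)) :=
      mul_pos (by positivity) (mul_pos h0 (by linarith))
    nlinarith
  · refine ⟨mul_pos hp ht, ?_⟩
    have hr0 : 0 ≤ x ^ 2 + y ^ 2 := by positivity
    generalize x ^ 2 + y ^ 2 = r at *
    have h3 : (1 - s) ^ 2 ≤ 1 := by nlinarith
    have h4 : (1 - s) ^ 2 * r ≤ t ^ 2 := by nlinarith
    have := mul_le_mul_of_nonneg_left h4 (sq_nonneg (2 + s))
    linarith
  · have := h 1 0 0 (by norm_num)
    by_contra! hc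
    nlinarith
  · have hr0 : 0 ≤ x ^ 2 + y ^ 2 := by positivity
    have h3 : 0 ≤ 1 - s := by linarith
    positivity
end

section
/- Let H be a real number with H < 3, set s = √(3−H) and Λ = H − 2 + s. Then: (WEC) [for all real t,x,y with x²+y² < t², (H−Λ)t² + (1+Λ)(x²+y²) ≥ 0] if and only if −1 ≤ H; (DEC) it is NOT the case that [for all real t,x,y with 0 < t and x²+y² ≤ t², one has 0 < (H−Λ)t and (H−Λ)²t² ≥ (1+Λ)²(x²+y²)] — i.e. the dominant energy condition fails for every H < 3; (SEC) [for all real t,x,y with x²+y² < t², 2(1+Λ)t² + (H−1−2Λ)(x²+y²) ≥ 0] if and only if −1 ≤ H. -/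
/-- Weak, dominant and strong energy conditions for the Einstein–Dirac solution of SqK
type (iii) (`Λ = H − 2 + √(3−H)`) on a three-dimensional Lorentzian Sasakian space-form;
the dominant energy condition fails for every `H < 3`. -/
theorem stmt13 (H : ℝ) (hH : H < 3) (s lambda : ℝ)
    (hs : s = Real.sqrt (3 - H)) (hlambda : lambda = H - 2 + s) :
    ((∀ t x y : ℝ, x ^ 2 + y ^ 2 < t ^ 2 →
        (H - lambda) * t ^ 2 + (1 + lambda) * (x ^ 2 + y ^ 2) ≥ 0) ↔ -1 ≤ H) ∧
    ¬ (∀ t x y : ℝ, 0 < t → x ^ 2 + y ^ 2 ≤ t ^ 2 →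
        0 < (H - lambda) * t ∧
          (H - lambda) ^ 2 * t ^ 2 ≥ (1 + lambda) ^ 2 * (x ^ 2 + y ^ 2)) ∧
    ((∀ t x y : ℝ, x ^ 2 + y ^ 2 < t ^ 2 →
        2 * (1 + lambda) * t ^ 2 + (H - 1 - 2 * lambda) * (x ^ 2 + y ^ 2) ≥ 0) ↔ -1 ≤ H) := by
  have hpos : 0 < s := by rw [hs]; exact Real.sqrt_pos.mpr (by linarith)
  have hsq : s ^ 2 = 3 - H := by rw [hs]; exact Real.sq_sqrt (by linarith)
  clear hs
  have e1 : H - lambda = 2 - s := by linarith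
  have e2 : 1 + lambda = (2 - s) * (1 + s) := by linarith
  have e3 : H - 1 - 2 * lambda = -((2 - s) * s) := by linarith
  have hiff : -1 ≤ H ↔ 0 ≤ 2 - s := by
    constructor
    · intro h
      nlinarith
    · intro h
      nlinarith
  rw [e1, e2, e3, hiff]
  refine ⟨⟨fun h => ?_, fun h t x y hr => ?_⟩, fun h => ?_, ⟨fun h => ?_, fun h t x y hr => ?_⟩⟩
  · have := h 1 0 0 (by norm_num)
    linarith
  · have h1 : 0 ≤ (2 - s) * (t ^ 2 + (1 + s) * (x ^ 2 + y ^ 2)) := mul_nonneg h (by positivity)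
    linarith
  · obtain ⟨h1, h2⟩ := h 1 1 0 (by norm_num) (by norm_num)
    have h3 : 0 < (2 - s) ^ 2 := by
      have : 0 < 2 - s := by linarith
      positivity
    have h4 : 0 < (2 - s) ^ 2 * (s * (2 + s)) := by positivity
    nlinarith
  · have := h 1 0 0 (by norm_num)
    by_contra hc
    push Not at hc
    nlinarith
  · have h0 : 0 ≤ s * (t ^ 2 - (x ^ 2 + y ^ 2)) := mul_nonneg hpos.le (by linarith)
    have h5 : 0 ≤ s * t ^ 2 := by positivity
    have h1 : 0 ≤ (2 - s) * (2 * (1 + s) * t ^ 2 - s * (x ^ 2 + y ^ 2)) :=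
      mul_nonneg h (by nlinarith [sq_nonneg t])
    linarith
end

section
/- Define M : ℝ → ℝ → Matrix (Fin 2) (Fin 2) ℂ by M(θ,φ) = [[cos(θ/2)·e^{√(−1)φ/2}, −√(−1)·sin(θ/2)·e^{−√(−1)φ/2}], [−√(−1)·sin(θ/2)·e^{√(−1)φ/2}, cos(θ/2)·e^{−√(−1)φ/2}]]. Then for all θ, φ ∈ ℝ: (1) the derivative of M in θ equals −(√(−1)/2)·[[0,1],[1,0]]·M(θ,φ); (2) the derivative of M in φ equals (1/2)·[[√(−1)cos θ, −sin θ],[sin θ, −√(−1)cos θ]]·M(θ,φ). -/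
open Complex

/-- The fundamental solution matrix `M(θ,φ)` for the `(f₁,f₂)`-system of the SqK-spinor
equations on the Berger sphere. -/
noncomputable def Mmat (θ φ : ℝ) : Matrix (Fin 2) (Fin 2) ℂ :=
  !![(Real.cos (θ / 2) : ℂ) * Complex.exp (Complex.I * φ / 2),
      -Complex.I * (Real.sin (θ / 2) : ℂ) * Complex.exp (-(Complex.I * φ) / 2);
    -Complex.I * (Real.sin (θ / 2) : ℂ) * Complex.exp (Complex.I * φ / 2),
      (Real.cos (θ / 2) : ℂ) * Complex.exp (-(Complex.I * φ) / 2)]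

/-- `M` satisfies `∂_θ M = −(i/2)[[0,1],[1,0]]M` and
`∂_φ M = (1/2)[[i cos θ, −sin θ],[sin θ, −i cos θ]]M` (entrywise derivatives). -/
theorem stmt18 :
    ∀ θ φ : ℝ,
      (∀ i j : Fin 2,
        HasDerivAt (fun t : ℝ => Mmat t φ i j)
          (((-(Complex.I) / 2) • ((!![0, 1; 1, 0] : Matrix (Fin 2) (Fin 2) ℂ) * Mmat θ φ)) i j)
          θ) ∧
      (∀ i j : Fin 2,
        HasDerivAt (fun t : ℝ => Mmat θ t i j)
          ((((1 : ℂ) / 2) •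
            ((!![Complex.I * (Real.cos θ : ℂ), -(Real.sin θ : ℂ);
                (Real.sin θ : ℂ), -Complex.I * (Real.cos θ : ℂ)] : Matrix (Fin 2) (Fin 2) ℂ) *
              Mmat θ φ)) i j)
          φ) := by
  intro θ φ
  have hs : HasDerivAt (fun t : ℝ => ((Real.sin (t / 2) : ℝ) : ℂ))
      ((Real.cos (θ / 2) : ℂ) / 2) θ := by
    have h := (((hasDerivAt_id θ).div_const 2).sin).ofReal_comp
    refine HasDerivAt.congr_deriv h ?_
    simp only [id]
    push_cast
    ring
  have hc : HasDerivAt (fun t : ℝ => ((Real.cos (t / 2) : ℝ) : ℂ))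
      (-(Real.sin (θ / 2) : ℂ) / 2) θ := by
    have h := (((hasDerivAt_id θ).div_const 2).cos).ofReal_comp
    refine HasDerivAt.congr_deriv h ?_
    simp only [id]
    push_cast
    ring
  have hp : HasDerivAt (fun t : ℝ => Complex.exp (Complex.I * t / 2))
      (Complex.exp (Complex.I * φ / 2) * (Complex.I / 2)) φ := by
    have h := ((((hasDerivAt_id φ).ofReal_comp).const_mul Complex.I).div_const 2).cexp
    refine HasDerivAt.congr_deriv h ?_
    simp
  have hm : HasDerivAt (fun t : ℝ => Complex.exp (-(Complex.I * t) / 2))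
      (Complex.exp (-(Complex.I * φ) / 2) * (-Complex.I / 2)) φ := by
    have h := ((((hasDerivAt_id φ).ofReal_comp).const_mul Complex.I).neg.div_const 2).cexp
    refine HasDerivAt.congr_deriv h ?_
    simp
  have I2 : Complex.I * Complex.I = -1 := Complex.I_mul_I
  have e1 : (Real.cos θ : ℂ) = (Real.cos (θ / 2) : ℂ) ^ 2 - (Real.sin (θ / 2) : ℂ) ^ 2 := by
    have h := Real.cos_two_mul' (θ / 2)
    rw [mul_div_cancel₀ θ (two_ne_zero)] at h
    exact_mod_cast h
  have e2 : (Real.sin θ : ℂ) = 2 * (Real.sin (θ / 2) : ℂ) * (Real.cos (θ / 2) : ℂ) := by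
    have h := Real.sin_two_mul (θ / 2)
    rw [mul_div_cancel₀ θ (two_ne_zero)] at h
    exact_mod_cast h
  have e3 : (Real.sin (θ / 2) : ℂ) ^ 2 + (Real.cos (θ / 2) : ℂ) ^ 2 = 1 := by
    exact_mod_cast Real.sin_sq_add_cos_sq (θ / 2)
  rw [e1, e2]
  simp only [Mmat]
  generalize (Real.sin (θ / 2) : ℂ) = s at *
  generalize (Real.cos (θ / 2) : ℂ) = c at *
  constructor
  · intro i j
    fin_cases i <;> fin_cases j <;>
      simp only [Matrix.smul_apply, Matrix.mul_apply, Fin.sum_univ_two, Matrix.of_apply,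
        Matrix.cons_val', Matrix.cons_val_zero, Matrix.cons_val_one, Matrix.cons_val_fin_one,
        smul_eq_mul, Fin.zero_eta, Fin.mk_one]
    · refine (hc.mul_const _).congr_deriv ?_
      grind
    · refine ((hs.const_mul _).mul_const _).congr_deriv ?_
      grind
    · refine ((hs.const_mul _).mul_const _).congr_deriv ?_
      grind
    · refine (hc.mul_const _).congr_deriv ?_
      grind
  · intro i j
    fin_cases i <;> fin_cases j <;>
      simp only [Matrix.smul_apply, Matrix.mul_apply, Fin.sum_univ_two, Matrix.of_apply,
        Matrix.cons_val', Matrix.cons_val_zero, Matrix.cons_val_one, Matrix.cons_val_fin_one,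
        smul_eq_mul, Fin.zero_eta, Fin.mk_one]
    · refine (hp.const_mul _).congr_deriv ?_
      grind
    · refine (hm.const_mul _).congr_deriv ?_
      grind
    · refine (hp.const_mul _).congr_deriv ?_
      grind
    · refine (hm.const_mul _).congr_deriv ?_
      grind
end

section
/- Let C₁, C₂ ∈ ℂ. Define u, w : ℝ² → ℂ by u(θ,φ) = cos(θ/2)e^{√(−1)φ/2}C₁ − √(−1)sin(θ/2)e^{−√(−1)φ/2}C₂ and w(θ,φ) = −√(−1)sin(θ/2)e^{√(−1)φ/2}C₁ + cos(θ/2)e^{−√(−1)φ/2}C₂, and define f, h : ℝ³ → ℂ by f(θ,φ,ϕ) = u(θ,φ)e^{√(−1)ϕ/2} + w(θ,φ)e^{−√(−1)ϕ/2} and h(θ,φ,ϕ) = −u(θ,φ)e^{√(−1)ϕ/2} + w(θ,φ)e^{−√(−1)ϕ/2}. Then at every point (θ,φ,ϕ) with sin θ ≠ 0, the following six equations hold (∂_θ, ∂_φ, ∂_ϕ denoting partial derivatives): (1) √(−1)h + 2∂_ϕ f = 0; (2) √(−1)f + 2∂_ϕ h = 0; (3) h/2 − sin(ϕ)∂_θ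 f − cos(ϕ)cot(θ)∂_ϕ f + (cos(ϕ)/sin(θ))∂_φ f = 0; (4) f/2 + sin(ϕ)∂_θ h + cos(ϕ)cot(θ)∂_ϕ h − (cos(ϕ)/sin(θ))∂_φ h = 0; (5) (√(−1)/2)f − sin(ϕ)cot(θ)∂_ϕ f + (sin(ϕ)/sin(θ))∂_φ f + cos(ϕ)∂_θ f = 0; (6) (√(−1)/2)h + sin(ϕ)cot(θ)∂_ϕ h − (sin(ϕ)/sin(θ))∂_φ h − cos(ϕ)∂_θ h = 0. -/
open Complex

/-- `u(θ,φ) = cos(θ/2)e^{iφ/2}C₁ − i sin(θ/2)e^{−iφ/2}C₂`. -/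
noncomputable def uF (C₁ C₂ : ℂ) (θ φ : ℝ) : ℂ :=
  (Real.cos (θ / 2) : ℂ) * Complex.exp (Complex.I * φ / 2) * C₁ -
    Complex.I * (Real.sin (θ / 2) : ℂ) * Complex.exp (-(Complex.I * φ) / 2) * C₂

/-- `w(θ,φ) = −i sin(θ/2)e^{iφ/2}C₁ + cos(θ/2)e^{−iφ/2}C₂`. -/
noncomputable def wF (C₁ C₂ : ℂ) (θ φ : ℝ) : ℂ :=
  -Complex.I * (Real.sin (θ / 2) : ℂ) * Complex.exp (Complex.I * φ / 2) * C₁ +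
    (Real.cos (θ / 2) : ℂ) * Complex.exp (-(Complex.I * φ) / 2) * C₂

/-- `f(θ,φ,ϕ) = u(θ,φ)e^{iϕ/2} + w(θ,φ)e^{−iϕ/2}`. -/
noncomputable def fF (C₁ C₂ : ℂ) (θ φ ϕ : ℝ) : ℂ :=
  uF C₁ C₂ θ φ * Complex.exp (Complex.I * ϕ / 2) +
    wF C₁ C₂ θ φ * Complex.exp (-(Complex.I * ϕ) / 2)

/-- `h(θ,φ,ϕ) = −u(θ,φ)e^{iϕ/2} + w(θ,φ)e^{−iϕ/2}`. -/
noncomputable def hF (C₁ C₂ : ℂ) (θ φ ϕ : ℝ) : ℂ :=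
  -uF C₁ C₂ θ φ * Complex.exp (Complex.I * ϕ / 2) +
    wF C₁ C₂ θ φ * Complex.exp (-(Complex.I * ϕ) / 2)

theorem aux_expP (φ : ℝ) : HasDerivAt (fun t : ℝ => Complex.exp (Complex.I * t / 2))
    (Complex.I / 2 * Complex.exp (Complex.I * φ / 2)) φ := by
  have h0 : HasDerivAt (fun t : ℝ => (t : ℂ)) 1 φ := Complex.ofRealCLM.hasDerivAt
  have h := ((h0.const_mul Complex.I).div_const 2).cexp
  convert h using 1
  ring

theorem aux_expM (φ : ℝ) : HasDerivAt (fun t : ℝ => Complex.exp (-(Complex.I * t) / 2))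
    (-Complex.I / 2 * Complex.exp (-(Complex.I * φ) / 2)) φ := by
  have h0 : HasDerivAt (fun t : ℝ => (t : ℂ)) 1 φ := Complex.ofRealCLM.hasDerivAt
  have h := (((h0.const_mul Complex.I).fun_neg).div_const 2).cexp
  convert h using 1
  ring

theorem aux_cos (θ : ℝ) : HasDerivAt (fun t : ℝ => ((Real.cos (t / 2) : ℝ) : ℂ))
    (-(Real.sin (θ / 2) : ℂ) / 2) θ := by
  have h := (((hasDerivAt_id θ).div_const 2).cos).ofReal_comp
  refine h.congr_deriv ?_
  simp only [id_eq]
  push_cast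
  ring

theorem aux_sin (θ : ℝ) : HasDerivAt (fun t : ℝ => ((Real.sin (t / 2) : ℝ) : ℂ))
    ((Real.cos (θ / 2) : ℂ) / 2) θ := by
  have h := (((hasDerivAt_id θ).div_const 2).sin).ofReal_comp
  refine h.congr_deriv ?_
  simp only [id_eq]
  push_cast
  ring

theorem aux_u_th (C₁ C₂ : ℂ) (θ φ : ℝ) :
    HasDerivAt (fun t => uF C₁ C₂ t φ) (-Complex.I / 2 * wF C₁ C₂ θ φ) θ := by
  unfold uF wF
  have h := (((aux_cos θ).mul_const (Complex.exp (Complex.I * φ / 2))).mul_const C₁).fun_sub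
    ((((aux_sin θ).const_mul Complex.I).mul_const (Complex.exp (-(Complex.I * φ) / 2))).mul_const C₂)
  refine h.congr_deriv ?_
  linear_combination (-(Real.sin (θ / 2) : ℂ) / 2 * Complex.exp (Complex.I * φ / 2) * C₁) * Complex.I_mul_I

theorem aux_w_th (C₁ C₂ : ℂ) (θ φ : ℝ) :
    HasDerivAt (fun t => wF C₁ C₂ t φ) (-Complex.I / 2 * uF C₁ C₂ θ φ) θ := by
  unfold uF wF
  have h := ((((aux_sin θ).const_mul (-Complex.I)).mul_const (Complex.exp (Complex.I * φ / 2))).mul_const C₁).fun_add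
    (((aux_cos θ).mul_const (Complex.exp (-(Complex.I * φ) / 2))).mul_const C₂)
  refine h.congr_deriv ?_
  linear_combination (-(Real.sin (θ / 2) : ℂ) / 2 * Complex.exp (-(Complex.I * φ) / 2) * C₂) * Complex.I_mul_I

theorem aux_u_ph (C₁ C₂ : ℂ) (θ φ : ℝ) :
    HasDerivAt (fun t => uF C₁ C₂ θ t)
      (Complex.I / 2 * (Real.cos θ * uF C₁ C₂ θ φ) - Real.sin θ / 2 * wF C₁ C₂ θ φ) φ := by
  unfold uF wF
  have h := (((aux_expP φ).const_mul (Real.cos (θ / 2) : ℂ)).mul_const C₁).fun_sub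
    (((aux_expM φ).const_mul (Complex.I * (Real.sin (θ / 2) : ℂ))).mul_const C₂)
  refine h.congr_deriv ?_
  have hs : (Real.sin θ : ℂ) = 2 * Real.sin (θ / 2) * Real.cos (θ / 2) := by
    rw [show θ = 2 * (θ / 2) by ring, Real.sin_two_mul]; push_cast; ring_nf
  have hc : (Real.cos θ : ℂ) = 2 * (Real.cos (θ / 2) : ℂ) ^ 2 - 1 := by
    rw [show θ = 2 * (θ / 2) by ring, Real.cos_two_mul]; push_cast; ring_nf
  have h1 : (Real.sin (θ / 2) : ℂ) ^ 2 + (Real.cos (θ / 2) : ℂ) ^ 2 = 1 := by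
    exact_mod_cast Real.sin_sq_add_cos_sq (θ / 2)
  rw [hs, hc]
  generalize (Real.sin (θ / 2) : ℂ) = s at *
  generalize (Real.cos (θ / 2) : ℂ) = c at *
  generalize Complex.exp (Complex.I * φ / 2) = P
  generalize Complex.exp (-(Complex.I * φ) / 2) = Q
  have hI := Complex.I_mul_I
  generalize Complex.I = J at *
  grind

theorem aux_w_ph (C₁ C₂ : ℂ) (θ φ : ℝ) :
    HasDerivAt (fun t => wF C₁ C₂ θ t)
      (-Complex.I / 2 * (Real.cos θ * wF C₁ C₂ θ φ) + Real.sin θ / 2 * uF C₁ C₂ θ φ) φ := by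
  unfold uF wF
  have h := (((aux_expP φ).const_mul (-Complex.I * (Real.sin (θ / 2) : ℂ))).mul_const C₁).fun_add
    (((aux_expM φ).const_mul (Real.cos (θ / 2) : ℂ)).mul_const C₂)
  refine h.congr_deriv ?_
  have hs : (Real.sin θ : ℂ) = 2 * Real.sin (θ / 2) * Real.cos (θ / 2) := by
    rw [show θ = 2 * (θ / 2) by ring, Real.sin_two_mul]; push_cast; ring_nf
  have hc : (Real.cos θ : ℂ) = 2 * (Real.cos (θ / 2) : ℂ) ^ 2 - 1 := by
    rw [show θ = 2 * (θ / 2) by ring, Real.cos_two_mul]; push_cast; ring_nf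
  have h1 : (Real.sin (θ / 2) : ℂ) ^ 2 + (Real.cos (θ / 2) : ℂ) ^ 2 = 1 := by
    exact_mod_cast Real.sin_sq_add_cos_sq (θ / 2)
  rw [hs, hc]
  generalize (Real.sin (θ / 2) : ℂ) = s at *
  generalize (Real.cos (θ / 2) : ℂ) = c at *
  generalize Complex.exp (Complex.I * φ / 2) = P
  generalize Complex.exp (-(Complex.I * φ) / 2) = Q
  have hI := Complex.I_mul_I
  generalize Complex.I = J at *
  grind

/-- The pair `(f,h)` solves the six SqK-spinor equations of type
`((1−√(3+H))/2, (−2+√(3+H))/2)` on the Berger sphere wherever `sin θ ≠ 0`. -/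
theorem stmt19 (C₁ C₂ : ℂ) :
    ∀ θ φ ϕ : ℝ, Real.sin θ ≠ 0 →
      (Complex.I * hF C₁ C₂ θ φ ϕ + 2 * deriv (fun t => fF C₁ C₂ θ φ t) ϕ = 0) ∧
      (Complex.I * fF C₁ C₂ θ φ ϕ + 2 * deriv (fun t => hF C₁ C₂ θ φ t) ϕ = 0) ∧
      (hF C₁ C₂ θ φ ϕ / 2 -
          (Real.sin ϕ : ℂ) * deriv (fun t => fF C₁ C₂ t φ ϕ) θ -
          (Real.cos ϕ : ℂ) * ((Real.cos θ / Real.sin θ : ℝ) : ℂ) *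
            deriv (fun t => fF C₁ C₂ θ φ t) ϕ +
          ((Real.cos ϕ / Real.sin θ : ℝ) : ℂ) * deriv (fun t => fF C₁ C₂ θ t ϕ) φ = 0) ∧
      (fF C₁ C₂ θ φ ϕ / 2 +
          (Real.sin ϕ : ℂ) * deriv (fun t => hF C₁ C₂ t φ ϕ) θ +
          (Real.cos ϕ : ℂ) * ((Real.cos θ / Real.sin θ : ℝ) : ℂ) *
            deriv (fun t => hF C₁ C₂ θ φ t) ϕ -
          ((Real.cos ϕ / Real.sin θ : ℝ) : ℂ) * deriv (fun t => hF C₁ C₂ θ t ϕ) φ = 0) ∧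
      (Complex.I * fF C₁ C₂ θ φ ϕ / 2 -
          (Real.sin ϕ : ℂ) * ((Real.cos θ / Real.sin θ : ℝ) : ℂ) *
            deriv (fun t => fF C₁ C₂ θ φ t) ϕ +
          ((Real.sin ϕ / Real.sin θ : ℝ) : ℂ) * deriv (fun t => fF C₁ C₂ θ t ϕ) φ +
          (Real.cos ϕ : ℂ) * deriv (fun t => fF C₁ C₂ t φ ϕ) θ = 0) ∧
      (Complex.I * hF C₁ C₂ θ φ ϕ / 2 +
          (Real.sin ϕ : ℂ) * ((Real.cos θ / Real.sin θ : ℝ) : ℂ) *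
            deriv (fun t => hF C₁ C₂ θ φ t) ϕ -
          ((Real.sin ϕ / Real.sin θ : ℝ) : ℂ) * deriv (fun t => hF C₁ C₂ θ t ϕ) φ -
          (Real.cos ϕ : ℂ) * deriv (fun t => hF C₁ C₂ t φ ϕ) θ = 0) := by
  intro θ φ ϕ hθ
  have hS : (Real.sin θ : ℂ) ≠ 0 := by exact_mod_cast hθ
  have ut := aux_u_th C₁ C₂ θ φ
  have wt := aux_w_th C₁ C₂ θ φ
  have up := aux_u_ph C₁ C₂ θ φ
  have wp := aux_w_ph C₁ C₂ θ φ
  have eP := aux_expP ϕ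
  have eM := aux_expM ϕ
  have d1 : deriv (fun t => fF C₁ C₂ θ φ t) ϕ = _ :=
    ((eP.const_mul (uF C₁ C₂ θ φ)).fun_add (eM.const_mul (wF C₁ C₂ θ φ))).deriv
  have d2 : deriv (fun t => hF C₁ C₂ θ φ t) ϕ = _ :=
    ((eP.const_mul (-uF C₁ C₂ θ φ)).fun_add (eM.const_mul (wF C₁ C₂ θ φ))).deriv
  have d3 : deriv (fun t => fF C₁ C₂ t φ ϕ) θ = _ :=
    ((ut.mul_const (Complex.exp (Complex.I * ϕ / 2))).fun_add
      (wt.mul_const (Complex.exp (-(Complex.I * ϕ) / 2)))).deriv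
  have d4 : deriv (fun t => hF C₁ C₂ t φ ϕ) θ = _ :=
    ((ut.fun_neg.mul_const (Complex.exp (Complex.I * ϕ / 2))).fun_add
      (wt.mul_const (Complex.exp (-(Complex.I * ϕ) / 2)))).deriv
  have d5 : deriv (fun t => fF C₁ C₂ θ t ϕ) φ = _ :=
    ((up.mul_const (Complex.exp (Complex.I * ϕ / 2))).fun_add
      (wp.mul_const (Complex.exp (-(Complex.I * ϕ) / 2)))).deriv
  have d6 : deriv (fun t => hF C₁ C₂ θ t ϕ) φ = _ :=
    ((up.fun_neg.mul_const (Complex.exp (Complex.I * ϕ / 2))).fun_add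
      (wp.mul_const (Complex.exp (-(Complex.I * ϕ) / 2)))).deriv
  rw [d1, d2, d3, d4, d5, d6]
  have q1 : ((Real.cos ϕ : ℂ) + Real.sin ϕ * Complex.I) * Complex.exp (-(Complex.I * ϕ) / 2) =
      Complex.exp (Complex.I * ϕ / 2) := by
    rw [Complex.ofReal_cos, Complex.ofReal_sin, ← Complex.exp_mul_I, ← Complex.exp_add]
    congr 1; ring
  have q2 : ((Real.cos ϕ : ℂ) - Real.sin ϕ * Complex.I) * Complex.exp (Complex.I * ϕ / 2) =
      Complex.exp (-(Complex.I * ϕ) / 2) := by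
    have : ((Real.cos ϕ : ℂ) - Real.sin ϕ * Complex.I) = Complex.exp (-(ϕ : ℂ) * Complex.I) := by
      rw [Complex.exp_mul_I, Complex.cos_neg, Complex.sin_neg, Complex.ofReal_cos, Complex.ofReal_sin]
      ring
    rw [this, ← Complex.exp_add]
    congr 1; ring
  have hI := Complex.I_mul_I
  simp only [fF, hF, Complex.ofReal_div]
  clear d1 d2 d3 d4 d5 d6 ut wt up wp eP eM
  generalize uF C₁ C₂ θ φ = u
  generalize wF C₁ C₂ θ φ = w
  generalize Complex.exp (Complex.I * ϕ / 2) = E at *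
  generalize Complex.exp (-(Complex.I * ϕ) / 2) = F at *
  generalize (Real.sin θ : ℂ) = S at *
  generalize (Real.cos θ : ℂ) = C at *
  generalize (Real.sin ϕ : ℂ) = s at *
  generalize (Real.cos ϕ : ℂ) = c at *
  generalize Complex.I = J at *
  refine ⟨by ring, by ring, ?_, ?_, ?_, ?_⟩
  · field_simp
    grind
  · field_simp
    grind
  · field_simp
    grind
  · field_simp
    grind
end
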